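/- Consider K users with parameters B, N0, T > 0, cloud capacity F' > 0, and for each k, β_k, C_k, P_k, h_k > 0, R_k ≥ 0, F_k ≥ 0, with b_k = F'·P_k·h_k²/N0 > 1 for all k. Define f(x) = N0·(2^{x/B} − 1), g(x) = f(x) − x·(N0·ln 2/B)·2^{x/B}, m_k⁺ = max(R_k − F_k·T/C_k, 0), a_k = F'·ln 2/(B·C_k), let z_k be the unique positive root of z·ln z + (a_k − 1)·z = b_k − 1, and set φ̂_k = (β_k·N0/h_k²)·(z_k·ln z_k − z_k + 1) if z_k ≥ 1 and φ̂_k = 0 otherwise. Let E(ℓ,t) = Σ_k β_k·[(t_k/h_k²)·f(ℓ_k/t_k) + (R_k − ℓ_k)·C_k·P_k] (with (t_k/h_k²)·f(ℓ_k/t_k) = 0 when t_k = 0) and D₃ = {(ℓ,t) : (Σ_k C_k·ℓ_k)/F' + Σ_k t_k ≤ T, t_k ≥ 0, m_k⁺ ≤ ℓ_k ≤ R_k, t_k > 0 whenever ℓ_k > 0}. If (ℓ*, t*) minimizes E over D₃ and t*_j > 0 for some j, then there exists λ̂* ≥ 0 such that for every k: (i) if φ̂_k < λ̂* then ℓ*_k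 = m_k⁺; (ii) if φ̂_k > λ̂* then ℓ*_k = R_k; (iii) if t*_k > 0 then g(ℓ*_k/t*_k) = −h_k²·λ̂*/β_k. -/

import Mathlib

open Filter Topology

/-- Directional derivative of the perspective `t * f (ℓ / t)` at a point with `t > 0`, or at the
origin along a ray of slope `x`. -/
lemma hasDerivAt_perspective_line {f f' : ℝ → ℝ} (hf : ∀ x, HasDerivAt f (f' x) x)
    {l t p q x : ℝ} (hx : (0 < t ∧ x = l / t) ∨ (t = 0 ∧ l = 0 ∧ p = x * q)) :
    HasDerivAt (fun ε : ℝ => (t + ε * q) * f ((l + ε * p) / (t + ε * q)))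
      (q * (f x - x * f' x) + p * f' x) 0 := by
  rcases hx with ⟨ht, rfl⟩ | ⟨rfl, rfl, rfl⟩
  · have h1 : HasDerivAt (fun ε : ℝ => t + ε * q) q 0 := by
      simpa using ((hasDerivAt_id (0 : ℝ)).mul_const q).const_add t
    have h2 : HasDerivAt (fun ε : ℝ => l + ε * p) p 0 := by
      simpa using ((hasDerivAt_id (0 : ℝ)).mul_const p).const_add l
    have ht0 : t + 0 * q ≠ 0 := by simpa using ht.ne'
    have h3 := h2.div h1 ht0
    have h4 := (hf ((l + 0 * p) / (t + 0 * q))).comp (0 : ℝ) h3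
    have h5 := h1.mul h4
    refine h5.congr_deriv ?_
    simp only [zero_mul, add_zero, Function.comp_apply, Pi.div_apply]
    field_simp
    ring
  · have h : (fun ε : ℝ => (0 + ε * q) * f ((0 + ε * (x * q)) / (0 + ε * q)))
        = fun ε => ε * (q * f x) := by
      funext ε
      by_cases he : ε * q = 0
      · simp [he, ← mul_assoc]
      · have : (0 + ε * (x * q)) / (0 + ε * q) = x := by
          rw [zero_add, zero_add, div_eq_iff he]; ring
        rw [this]; ring
    rw [h]
    refine ((hasDerivAt_id (0 : ℝ)).mul_const (q * f x)).congr_deriv ?_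
    ring

lemma HasDerivAt.nonneg_of_eventually_le {F : ℝ → ℝ} {d : ℝ} (hF : HasDerivAt F d 0)
    (h : ∀ᶠ ε in 𝓝[>] (0 : ℝ), F 0 ≤ F ε) : 0 ≤ d := by
  have h1 := (hasDerivWithinAt_iff_tendsto_slope' (s := Set.Ioi (0 : ℝ)) (by simp)).1
    hF.hasDerivWithinAt
  refine ge_of_tendsto h1 ?_
  filter_upwards [h, self_mem_nhdsWithin] with ε he hpos
  rw [slope_def_field]
  exact div_nonneg (sub_nonneg.2 he) (by simpa using (Set.mem_Ioi.1 hpos).le)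

lemma eventually_lt_add_mul {c l : ℝ} (p : ℝ) (h : c < l) :
    ∀ᶠ ε in 𝓝[>] (0 : ℝ), c < l + ε * p := by
  have hc : Tendsto (fun ε : ℝ => l + ε * p) (𝓝[>] 0) (𝓝 l) := by
    have : Continuous fun ε : ℝ => l + ε * p := by fun_prop
    simpa using (this.tendsto 0).mono_left nhdsWithin_le_nhds
  exact hc.eventually_const_lt h

lemma eventually_le_add_mul {c l p : ℝ} (h : c ≤ l) (hp : p < 0 → c < l) :
    ∀ᶠ ε in 𝓝[>] (0 : ℝ), c ≤ l + ε * p := by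
  rcases lt_or_ge p 0 with hp0 | hp0
  · exact (eventually_lt_add_mul p (hp hp0)).mono fun _ => le_of_lt
  · filter_upwards [self_mem_nhdsWithin] with ε he
    have := mul_nonneg (Set.mem_Ioi.1 he).le hp0
    linarith

/-- First-order necessary condition for a minimizer of a sum of perspectives, along a feasible
direction `(p, q)`. -/
lemma perspective_first_order_condition {ι : Type*} [Fintype ι] {f f' : ℝ → ℝ}
    (hf : ∀ x, HasDerivAt f (f' x) x) {β H W R C m l t p q x : ι → ℝ} {F T : ℝ}
    (hT : (∑ k, C k * l k) / F + ∑ k, t k ≤ T)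
    (hl : ∀ k, m k ≤ l k ∧ l k ≤ R k)
    (hmin : ∀ l' t' : ι → ℝ, (∑ k, C k * l' k) / F + ∑ k, t' k ≤ T → (∀ k, 0 ≤ t' k) →
      (∀ k, m k ≤ l' k ∧ l' k ≤ R k) → (∀ k, 0 < l' k → 0 < t' k) →
      ∑ k, β k * (t k / H k * f (l k / t k) + (R k - l k) * W k) ≤
        ∑ k, β k * (t' k / H k * f (l' k / t' k) + (R k - l' k) * W k))
    (hpq : (∑ k, C k * p k) / F + ∑ k, q k ≤ 0)
    (hx : ∀ k, (0 < t k ∧ x k = l k / t k) ∨ (t k = 0 ∧ l k = 0 ∧ p k = x k * q k ∧ 0 ≤ q k))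
    (hm : ∀ k, p k < 0 → m k < l k) (hR : ∀ k, 0 < p k → l k < R k) :
    0 ≤ ∑ k, (p k * (β k * (f' (x k) / H k - W k)) +
      q k * (β k * (f (x k) - x k * f' (x k)) / H k)) := by
  have hd : HasDerivAt (fun ε : ℝ => ∑ k, β k * ((t k + ε * q k) / H k *
      f ((l k + ε * p k) / (t k + ε * q k)) + (R k - (l k + ε * p k)) * W k))
      (∑ k, (p k * (β k * (f' (x k) / H k - W k)) +
        q k * (β k * (f (x k) - x k * f' (x k)) / H k))) 0 := by
    refine HasDerivAt.fun_sum fun k _ => ?_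
    have h1 := hasDerivAt_perspective_line hf (l := l k) (t := t k) (p := p k) (q := q k)
      (x := x k) ((hx k).imp id fun h => ⟨h.1, h.2.1, h.2.2.1⟩)
    have h2 := (hasDerivAt_id (0 : ℝ)).mul_const (p k * W k)
    have h3 := (((h1.div_const (H k)).sub h2).add_const ((R k - l k) * W k)).const_mul (β k)
    refine (h3.congr_deriv ?_).congr_of_eventuallyEq (Eventually.of_forall fun ε => ?_)
    · ring
    · simp only [Pi.sub_apply, id_eq]
      ring
  refine hd.nonneg_of_eventually_le ?_
  have e1 : ∀ᶠ ε in 𝓝[>] (0 : ℝ), ∀ k, m k ≤ l k + ε * p k :=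
    eventually_all.2 fun k => eventually_le_add_mul (hl k).1 (hm k)
  have e2 : ∀ᶠ ε in 𝓝[>] (0 : ℝ), ∀ k, -R k ≤ -l k + ε * -p k :=
    eventually_all.2 fun k => eventually_le_add_mul (neg_le_neg (hl k).2)
      fun h => neg_lt_neg (hR k (by linarith))
  have e3 : ∀ᶠ ε in 𝓝[>] (0 : ℝ), ∀ k, 0 < t k → 0 < t k + ε * q k :=
    eventually_all.2 fun k => by
      by_cases h : 0 < t k
      · exact (eventually_lt_add_mul (q k) h).mono fun _ h' _ => h'
      · exact Eventually.of_forall fun _ h' => absurd h' h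
  filter_upwards [e1, e2, e3, self_mem_nhdsWithin] with ε h1 h2 h3 hε
  have hε : 0 < ε := hε
  have key := hmin (fun k => l k + ε * p k) (fun k => t k + ε * q k) ?_ ?_ ?_ ?_
  · simpa using key
  · have : (∑ k, C k * (l k + ε * p k)) / F + ∑ k, (t k + ε * q k) =
        ((∑ k, C k * l k) / F + ∑ k, t k) + ε * ((∑ k, C k * p k) / F + ∑ k, q k) := by
      have h4 : ∑ k, C k * (l k + ε * p k) = ∑ k, C k * l k + ε * ∑ k, C k * p k := by
        rw [Finset.mul_sum, ← Finset.sum_add_distrib]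
        exact Finset.sum_congr rfl fun k _ => by ring
      rw [h4, Finset.sum_add_distrib, ← Finset.mul_sum]
      ring
    have h5 := mul_nonpos_of_nonneg_of_nonpos hε.le hpq
    linarith
  · intro k
    rcases hx k with h | h
    · exact (h3 k h.1).le
    · have := mul_nonneg hε.le h.2.2.2
      rw [h.1]; linarith
  · intro k
    have := h1 k
    have := h2 k
    constructor <;> linarith
  · intro k hk
    rcases hx k with h | ⟨ht, hl0, hp, hq⟩
    · exact h3 k h.1
    · rcases hq.eq_or_lt with hq | hq
      · simp [hl0, hp, ← hq] at hk
      · have := mul_pos hε hq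
        simp only [ht]; linarith

lemma mul_log_sub_add_one_nonneg {y : ℝ} (hy : 0 < y) : 0 ≤ y * Real.log y - y + 1 := by
  have h := mul_le_mul_of_nonneg_left (Real.one_sub_inv_le_log_of_pos hy) hy.le
  rw [mul_sub, mul_inv_cancel₀ hy.ne'] at h
  linarith

lemma mul_log_sub_add_one_mono {u v : ℝ} (hu : 1 ≤ u) (huv : u ≤ v) :
    u * Real.log u - u + 1 ≤ v * Real.log v - v + 1 := by
  have hu0 : 0 < u := by linarith
  have hv0 : 0 < v := by linarith
  have h := mul_le_mul_of_nonneg_left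
    (Real.one_sub_inv_le_log_of_pos (div_pos hv0 hu0)) hv0.le
  rw [Real.log_div hv0.ne' hu0.ne', inv_div, mul_sub, mul_div_cancel₀ _ hv0.ne'] at h
  have := mul_nonneg (sub_nonneg.2 huv) (Real.log_nonneg hu)
  linarith

lemma lt_mul_log_add_of_root_lt {a b z y : ℝ} (hb : 1 < b) (hz : 0 < z)
    (h : z * Real.log z + (a - 1) * z = b - 1) (hzy : z < y) :
    b - 1 < y * Real.log y + (a - 1) * y := by
  have hl := Real.log_lt_log hz hzy
  have hs : 0 < Real.log z + (a - 1) := by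
    by_contra! hs
    have := mul_nonpos_of_nonneg_of_nonpos hz.le hs
    linarith
  nlinarith [mul_lt_mul_of_pos_left hl (hz.trans hzy), mul_lt_mul_of_pos_right hzy hs]

lemma mul_log_add_lt_of_lt_root {a b z y : ℝ} (hb : 1 < b) (hy : 0 < y)
    (h : z * Real.log z + (a - 1) * z = b - 1) (hyz : y < z) :
    y * Real.log y + (a - 1) * y < b - 1 := by
  have hl := Real.log_lt_log hy hyz
  have hs : 0 < Real.log z + (a - 1) := by
    by_contra! hs
    have := mul_nonpos_of_nonneg_of_nonpos (hy.trans hyz).le hs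
    linarith
  nlinarith [mul_lt_mul_of_pos_left hl hy, mul_lt_mul_of_pos_right hyz hs]


/-- Theorem 3: threshold-based structure of the optimal resource allocation for
TDMA MECO with a finite-capacity cloud with non-negligible computing time
(Problem P3), expressed in terms of the priority function `φ̂_k` built from the
positive root `z_k` of `z·ln z + (a_k − 1)·z = b_k − 1`. -/
theorem tdma_meco_nonnegligible_time_threshold (K : ℕ) (B N0 T F' : ℝ)
    (hB : 0 < B) (hN0 : 0 < N0) (hT : 0 < T) (hF' : 0 < F')
    (β C P h R Floc : Fin K → ℝ)
    (hβ : ∀ k, 0 < β k) (hC : ∀ k, 0 < C k) (hP : ∀ k, 0 < P k) (hh : ∀ k, 0 < h k)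
    (hR : ∀ k, 0 ≤ R k) (hFloc : ∀ k, 0 ≤ Floc k)
    (f g : ℝ → ℝ)
    (hf : ∀ x, f x = N0 * ((2 : ℝ) ^ (x / B) - 1))
    (hg : ∀ x, g x = f x - x * (N0 * Real.log 2 / B * (2 : ℝ) ^ (x / B)))
    (mplus : Fin K → ℝ) (hm : ∀ k, mplus k = max (R k - Floc k * T / C k) 0)
    (a b : Fin K → ℝ)
    (hab : ∀ k, a k = F' * Real.log 2 / (B * C k) ∧ b k = F' * P k * (h k) ^ 2 / N0)
    (hb1 : ∀ k, 1 < b k)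
    (z : Fin K → ℝ)
    (hz : ∀ k, 0 < z k ∧ z k * Real.log (z k) + (a k - 1) * z k = b k - 1)
    (φhat : Fin K → ℝ)
    (hφhat : ∀ k, φhat k = if 1 ≤ z k then
      (β k * N0 / (h k) ^ 2) * (z k * Real.log (z k) - z k + 1) else 0)
    (E : (Fin K → ℝ) → (Fin K → ℝ) → ℝ)
    (hE : ∀ ℓ t, E ℓ t =
      ∑ k, β k * ((t k / (h k) ^ 2) * f (ℓ k / t k) + (R k - ℓ k) * C k * P k))
    (D3 : (Fin K → ℝ) → (Fin K → ℝ) → Prop)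
    (hD3 : ∀ ℓ t, D3 ℓ t ↔
      ((∑ k, C k * ℓ k) / F' + (∑ k, t k) ≤ T ∧ (∀ k, 0 ≤ t k) ∧
       (∀ k, mplus k ≤ ℓ k ∧ ℓ k ≤ R k) ∧ (∀ k, 0 < ℓ k → 0 < t k)))
    (ℓs ts : Fin K → ℝ)
    (hfeas : D3 ℓs ts)
    (hmin : ∀ ℓ t, D3 ℓ t → E ℓs ts ≤ E ℓ t)
    (j : Fin K) (hj : 0 < ts j) :
    ∃ lam : ℝ, 0 ≤ lam ∧
      ∀ k, (φhat k < lam → ℓs k = mplus k) ∧ (lam < φhat k → ℓs k = R k) ∧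
        (0 < ts k → g (ℓs k / ts k) = -((h k) ^ 2) * lam / β k) := by

  obtain ⟨hTs, ht0, hls, hlt⟩ := (hD3 _ _).1 hfeas
  have hlog2 : 0 < Real.log 2 := Real.log_pos one_lt_two
  have hm0 : ∀ k, 0 ≤ mplus k := fun k => by rw [hm]; exact le_max_right _ _
  have hl0 : ∀ k, ts k = 0 → ℓs k = 0 := fun k hk => by
    by_contra hne
    have := hlt k (lt_of_le_of_ne ((hm0 k).trans (hls k).1) (Ne.symm hne))
    linarith
  set Y : ℝ → ℝ := fun x => (2 : ℝ) ^ (x / B) with hY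
  have hYpos : ∀ x, 0 < Y x := fun x => Real.rpow_pos_of_pos two_pos _
  have hYlog : ∀ x, Real.log (Y x) = x / B * Real.log 2 := fun x => Real.log_rpow two_pos _
  have hfd : ∀ x, HasDerivAt f (N0 * Real.log 2 / B * Y x) x := fun x => by
    rw [funext hf]
    have h1 := (((hasDerivAt_id x).div_const B).const_rpow two_pos).sub_const 1 |>.const_mul N0
    refine h1.congr_deriv ?_
    simp only [hY, id_eq]
    ring
  have hgY : ∀ x, g x = -(N0 * (Y x * Real.log (Y x) - Y x + 1)) := fun x => by
    rw [hg, hf, hYlog]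
    simp only [hY]
    ring
  set lam : ℝ := -(β j * g (ℓs j / ts j) / h j ^ 2) with hlam
  -- Variation of user `k` by `(u, v)`, the time being taken from user `j`.
  have hvar : ∀ (k : Fin K) (u v x : ℝ),
      ((0 < ts k ∧ x = ℓs k / ts k) ∨ (ts k = 0 ∧ u = x * v ∧ 0 ≤ v)) →
      (u < 0 → mplus k < ℓs k) → (0 < u → ℓs k < R k) →
      0 ≤ u * (β k * (N0 * Real.log 2 / B * Y x / h k ^ 2 - C k * P k)) +
        v * (β k * g x / h k ^ 2) + (v + C k * u / F') * lam := by
    intro k u v x hx hu1 hu2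
    have hxj : Function.update (fun i => ℓs i / ts i) k x j = ℓs j / ts j := by
      by_cases hjk : j = k
      · subst hjk
        rcases hx with hx | hx
        · simp [hx.2]
        · linarith [hx.1]
      · simp [hjk]
    have key := perspective_first_order_condition hfd (β := β) (H := fun k => h k ^ 2)
      (W := fun k => C k * P k) (R := R) (C := C) (m := mplus) (l := ℓs) (t := ts)
      (p := Pi.single k u) (q := Pi.single k v - Pi.single j (v + C k * u / F'))
      (x := Function.update (fun i => ℓs i / ts i) k x) (F := F') (T := T) hTs hls
      (fun l' t' h1 h2 h3 h4 => by
        have := hmin l' t' ((hD3 _ _).2 ⟨h1, h2, h3, h4⟩)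
        simpa only [hE, mul_assoc] using this)
      (by
        simp [Pi.single_apply, Finset.sum_sub_distrib])
      (fun i => by
        by_cases hik : i = k
        · subst hik
          rcases hx with hx | ⟨hti, hu, hv⟩
          · exact Or.inl ⟨hx.1, by simp [hx.2]⟩
          · have hij : i ≠ j := fun hij => by rw [hij] at hti; linarith
            exact Or.inr ⟨hti, hl0 i hti, by simp [hij, hu], by simp [hij, hv]⟩
        · rcases (ht0 i).eq_or_lt with hti | hti
          · have hij : i ≠ j := fun hij => by rw [hij] at hti; linarith
            exact Or.inr ⟨hti.symm, hl0 i hti.symm, by simp [hij, hik], by simp [hij, hik]⟩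
          · exact Or.inl ⟨hti, by simp [hik]⟩)
      (fun i => by
        by_cases hik : i = k
        · subst hik; simpa using hu1
        · simp [hik])
      (fun i => by
        by_cases hik : i = k
        · subst hik; simpa using hu2
        · simp [hik])
    have hg' : ∀ y, f y - y * (N0 * Real.log 2 / B * Y y) = g y := fun y => (hg y).symm
    simp only [hg', Pi.sub_apply, sub_mul, Finset.sum_add_distrib, Finset.sum_sub_distrib,
      Pi.single_apply, ite_mul, zero_mul, Finset.sum_ite_eq', Finset.mem_univ, if_true, hxj,
      Function.update_self] at key
    rw [hlam]
    linarith
  have hG : ∀ k, 0 < ts k → β k * g (ℓs k / ts k) / h k ^ 2 = -lam := fun k hk => by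
    have h1 := hvar k 0 1 _ (Or.inl ⟨hk, rfl⟩) (by simp) (by simp)
    have h2 := hvar k 0 (-1) _ (Or.inl ⟨hk, rfl⟩) (by simp) (by simp)
    simp only [mul_zero, zero_div, add_zero, zero_mul, zero_add] at h1 h2
    linarith
  have hc : ∀ k, 0 < β k * N0 / h k ^ 2 := fun k =>
    div_pos (mul_pos (hβ k) hN0) (pow_pos (hh k) 2)
  have hgc : ∀ k x, β k * g x / h k ^ 2 =
      -(β k * N0 / h k ^ 2 * (Y x * Real.log (Y x) - Y x + 1)) := fun k x => by
    rw [hgY]; ring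
  have hA : ∀ k x, β k * (N0 * Real.log 2 / B * Y x / h k ^ 2 - C k * P k) =
      β k * N0 / h k ^ 2 * (C k / F') * (a k * Y x - b k) := fun k x => by
    rw [(hab k).1, (hab k).2]
    have := (hh k).ne'
    have := (hC k).ne'
    field_simp
  have hlam0 : 0 ≤ lam := by
    rw [hlam, hgc, neg_neg]
    exact mul_nonneg (hc j).le (mul_log_sub_add_one_nonneg (hYpos _))
  have hY1 : ∀ k, 1 ≤ Y (ℓs k / ts k) := fun k =>
    Real.one_le_rpow one_le_two
      (div_nonneg (div_nonneg ((hm0 k).trans (hls k).1) (ht0 k)) hB.le)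
  have hcC : ∀ k, 0 < β k * N0 / h k ^ 2 * (C k / F') := fun k =>
    mul_pos (hc k) (div_pos (hC k) hF')
  have hdl : ∀ k, 0 < ts k → ∀ u : ℝ, (u < 0 → mplus k < ℓs k) → (0 < u → ℓs k < R k) →
      0 ≤ u * (β k * N0 / h k ^ 2 * (C k / F') * (Y (ℓs k / ts k) * Real.log (Y (ℓs k / ts k)) +
        (a k - 1) * Y (ℓs k / ts k) - (b k - 1))) := fun k hk u hu1 hu2 => by
    have h1 := hvar k u 0 _ (Or.inl ⟨hk, rfl⟩) hu1 hu2
    have h2 := hG k hk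
    rw [hgc, neg_inj] at h2
    rw [hA, ← h2] at h1
    refine h1.trans_eq ?_
    ring
  refine ⟨lam, hlam0, fun k => ⟨fun hk => ?_, fun hk => ?_, fun hk => ?_⟩⟩
  · rcases (ht0 k).eq_or_lt with htk | htk
    · exact le_antisymm ((hl0 k htk.symm).le.trans (hm0 k)) (hls k).1
    by_contra hne
    have h1 := hdl k htk (-1) (fun _ => lt_of_le_of_ne (hls k).1 (Ne.symm hne))
      (fun h => by linarith)
    have h2 := hG k htk
    rw [hgc, neg_inj] at h2
    have hzY : z k < Y (ℓs k / ts k) := by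
      by_contra! hYz
      rw [hφhat, if_pos ((hY1 k).trans hYz), ← h2] at hk
      exact absurd (mul_le_mul_of_nonneg_left (mul_log_sub_add_one_mono (hY1 k) hYz) (hc k).le)
        (not_le.2 hk)
    have h3 := lt_mul_log_add_of_root_lt (hb1 k) (hz k).1 (hz k).2 hzY
    have := mul_pos (hcC k) (sub_pos.2 h3)
    linarith
  · have hz1 : 1 ≤ z k := by
      by_contra hz1
      rw [hφhat, if_neg hz1] at hk
      linarith
    have hφ := hφhat k
    rw [if_pos hz1] at hφ
    by_contra hne
    have hlR : ℓs k < R k := lt_of_le_of_ne (hls k).2 hne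
    rcases (ht0 k).eq_or_lt with htk | htk
    · set X : ℝ := B * Real.log (z k) / Real.log 2 with hX
      have hYX : Y X = z k := by
        refine Real.log_injOn_pos (hYpos X) (hz k).1 ?_
        rw [hYlog, hX]
        field_simp
      have hX0 : 0 ≤ X := div_nonneg (mul_nonneg hB.le (Real.log_nonneg hz1)) hlog2.le
      have h1 := hvar k X 1 X (Or.inr ⟨htk.symm, by simp, zero_le_one⟩)
        (fun h => by linarith) (fun _ => hlR)
      rw [hA, hgc, hYX, ← hφ] at h1
      have h2 : β k * N0 / h k ^ 2 * (C k / F') * (a k * z k - b k) = -(C k / F' * φhat k) := by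
        rw [hφ]
        linear_combination (β k * N0 / h k ^ 2 * (C k / F')) * (hz k).2
      rw [h2] at h1
      have h3 : 0 < (1 + C k * X / F') * (φhat k - lam) :=
        mul_pos (add_pos_of_pos_of_nonneg one_pos
          (div_nonneg (mul_nonneg (hC k).le hX0) hF'.le)) (sub_pos.2 hk)
      have h4 : X * -(C k / F' * φhat k) + 1 * -φhat k + (1 + C k * X / F') * lam =
        -((1 + C k * X / F') * (φhat k - lam)) := by ring
      linarith
    · have h1 := hdl k htk 1 (fun h => by linarith) (fun _ => hlR)
      have h2 := hG k htk
      rw [hgc, neg_inj] at h2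
      have hYz : Y (ℓs k / ts k) < z k := by
        by_contra! hzY
        rw [hφ, ← h2] at hk
        exact absurd (mul_le_mul_of_nonneg_left (mul_log_sub_add_one_mono hz1 hzY) (hc k).le)
          (not_le.2 hk)
      have h3 := mul_log_add_lt_of_lt_root (hb1 k) (hYpos _) (hz k).2 hYz
      have := mul_neg_of_pos_of_neg (hcC k) (sub_neg.2 h3)
      linarith
  · have h1 := hG k hk
    have := (hh k).ne'
    rw [div_eq_iff (pow_ne_zero 2 this)] at h1
    rw [eq_div_iff (hβ k).ne']
    linarith
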